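/- Let n ≥ 1 and 1 ≤ i ≤ n. Then the number of subsets S ⊆ {1,…,n} such that π_S(i) = i equals 2^{i−1} + 2^{n−i}. Consequently, under the Gilbert–Shannon–Reeds one-time riffle shuffle (in which each subset S occurs with probability 1/2^n), the probability that the card labeled i stays at position i is (2^{i−1} + 2^{n−i})/2^n = 1/2^{n−i+1} + 1/2^{i}. -/

import Mathlib

/-- The riffle-shuffle permutation determined by a subset `S` of the positions (0-indexed):
a label `i` with `i < |S|` is sent to the `(i+1)`-st smallest element of `S`, and a label `i`
with `|S| ≤ i` is sent to the `(i - |S| + 1)`-st smallest element of the complement of `S`. -/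
noncomputable def riffle {n : ℕ} (S : Finset (Fin n)) (i : Fin n) : Fin n :=
  if h : (i : ℕ) < S.card then
    S.orderEmbOfFin rfl ⟨(i : ℕ), h⟩
  else
    Sᶜ.orderEmbOfFin (by rw [Finset.card_compl, Fintype.card_fin])
      ⟨(i : ℕ) - S.card, by
        have hi := i.isLt
        have hc : S.card ≤ n := S.card_le_univ.trans_eq (by simp)
        omega⟩

theorem Finset.card_filter_lt_orderEmbOfFin {α : Type*} [LinearOrder α] (T : Finset α) {k : ℕ}
    (h : T.card = k) (m : Fin k) :
    (T.filter (· < T.orderEmbOfFin h m)).card = m := by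
  have : T.filter (· < T.orderEmbOfFin h m)
      = (Finset.Iio m).map (T.orderEmbOfFin h).toEmbedding := by
    ext x
    simp only [Finset.mem_filter, Finset.mem_map, Finset.mem_Iio]
    constructor
    · rintro ⟨hx, hlt⟩
      obtain ⟨y, rfl⟩ : x ∈ Set.range (T.orderEmbOfFin h) := by
        rwa [Finset.range_orderEmbOfFin, Finset.mem_coe]
      exact ⟨y, (T.orderEmbOfFin h).lt_iff_lt.mp hlt, rfl⟩
    · rintro ⟨y, hy, rfl⟩
      exact ⟨T.orderEmbOfFin_mem h y, (T.orderEmbOfFin h).lt_iff_lt.mpr hy⟩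
  rw [this, Finset.card_map, Fin.card_Iio]

theorem Finset.orderEmbOfFin_eq_iff {α : Type*} [LinearOrder α] (T : Finset α) {k : ℕ}
    (h : T.card = k) (m : Fin k) (a : α) :
    T.orderEmbOfFin h m = a ↔ a ∈ T ∧ (T.filter (· < a)).card = m := by
  constructor
  · rintro rfl
    exact ⟨T.orderEmbOfFin_mem h m, T.card_filter_lt_orderEmbOfFin h m⟩
  · rintro ⟨ha, hc⟩
    obtain ⟨y, rfl⟩ : a ∈ Set.range (T.orderEmbOfFin h) := by
      rwa [Finset.range_orderEmbOfFin, Finset.mem_coe]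
    rw [T.card_filter_lt_orderEmbOfFin h y] at hc
    rw [Fin.ext hc]

theorem riffle_eq_self_iff {n : ℕ} (S : Finset (Fin n)) (j : Fin n) :
    riffle S j = j ↔ Finset.Iic j ⊆ S ∨ S ⊆ Finset.Iio j := by
  have card_of_Iic_subset (h : Finset.Iic j ⊆ S) : (j : ℕ) < S.card := by
    have := Finset.card_le_card h
    rwa [Fin.card_Iic] at this
  have card_of_subset_Iio (h : S ⊆ Finset.Iio j) : S.card ≤ j := by
    simpa using Finset.card_le_card h
  unfold riffle
  split_ifs with hj
  · rw [Finset.orderEmbOfFin_eq_iff]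
    rw [or_iff_left (fun h => (card_of_subset_Iio h).not_gt hj)]
    constructor
    · rintro ⟨hmem, hc⟩
      have hsub : S.filter (· < j) ⊆ Finset.Iio j := fun x hx => by simp_all
      have heq := Finset.eq_of_subset_of_card_le hsub (by simp [hc])
      intro x hx
      rcases (Finset.mem_Iic.mp hx).eq_or_lt with rfl | hlt
      · exact hmem
      · exact (Finset.mem_filter.mp (heq ▸ Finset.mem_Iio.mpr hlt)).1
    · intro h
      refine ⟨h (Finset.mem_Iic.mpr le_rfl), ?_⟩
      have heq : S.filter (· < j) = Finset.Iio j := by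
        ext x
        simpa using fun hx : x < j => h (Finset.mem_Iic.mpr hx.le)
      simp [heq]
  · rw [Finset.orderEmbOfFin_eq_iff]
    rw [or_iff_right (fun h => hj (card_of_Iic_subset h))]
    have hsum : (S.filter (· < j)).card + (Sᶜ.filter (· < j)).card = j := by
      rw [← Finset.card_union_of_disjoint
        (Finset.disjoint_filter_filter disjoint_compl_right), ← Finset.filter_union,
        Finset.union_compl, Finset.filter_gt_eq_Iio, Fin.card_Iio]
    have hle := Finset.card_filter_le S (· < j)
    constructor
    · rintro ⟨-, hc⟩
      have heq := Finset.eq_of_subset_of_card_le (Finset.filter_subset (· < j) S)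
        (by dsimp only at hc; omega)
      intro x hx
      rw [← heq] at hx
      exact Finset.mem_Iio.mpr (Finset.mem_filter.mp hx).2
    · intro h
      have heq : S.filter (· < j) = S :=
        Finset.filter_true_of_mem fun x hx => Finset.mem_Iio.mp (h hx)
      refine ⟨Finset.mem_compl.mpr fun hmem => lt_irrefl j (Finset.mem_Iio.mp (h hmem)), ?_⟩
      rw [heq] at hsum
      dsimp only
      omega

theorem card_filter_riffle_eq_self {n : ℕ} (j : Fin n) :
    (Finset.univ.filter (fun S : Finset (Fin n) => riffle S j = j)).card
      = 2 ^ (j : ℕ) + 2 ^ (n - (j + 1)) := by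
  have hset : Finset.univ.filter (fun S : Finset (Fin n) => riffle S j = j)
      = Finset.Iic (Finset.Iio j) ∪ Finset.Icc (Finset.Iic j) Finset.univ := by
    ext S
    simp [riffle_eq_self_iff, or_comm]
  have hdisj : Disjoint (Finset.Iic (Finset.Iio j))
      (Finset.Icc (Finset.Iic j) (Finset.univ : Finset (Fin n))) := by
    rw [Finset.disjoint_left]
    intro S h₁ h₂
    have hmem := (Finset.mem_Icc.mp h₂).1 (Finset.mem_Iic.mpr (le_refl j))
    exact lt_irrefl j (Finset.mem_Iio.mp (Finset.mem_Iic.mp h₁ hmem))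
  rw [hset, Finset.card_union_of_disjoint hdisj, Finset.card_Iic_finset,
    Finset.card_Icc_finset (Finset.subset_univ _), Fin.card_Iio, Fin.card_Iic,
    Finset.card_univ, Fintype.card_fin]

theorem stmt19 (n i : ℕ) (hn : 1 ≤ n) (hi : 1 ≤ i) (hin : i ≤ n) :
    (Finset.univ.filter (fun S : Finset (Fin n) =>
        riffle S ⟨i - 1, by omega⟩ = ⟨i - 1, by omega⟩)).card
      = 2 ^ (i - 1) + 2 ^ (n - i) ∧
    ((Finset.univ.filter (fun S : Finset (Fin n) =>
        riffle S ⟨i - 1, by omega⟩ = ⟨i - 1, by omega⟩)).card : ℝ) / 2 ^ n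
      = 1 / 2 ^ (n - i + 1) + 1 / 2 ^ i := by
  have hcard := card_filter_riffle_eq_self (⟨i - 1, by omega⟩ : Fin n)
  simp only [Nat.sub_add_cancel hi] at hcard
  refine ⟨hcard, ?_⟩
  rw [hcard]
  obtain ⟨k, rfl⟩ := Nat.exists_eq_add_of_le' hi
  obtain ⟨m, rfl⟩ := Nat.exists_eq_add_of_le hin
  rw [Nat.add_sub_cancel_left, Nat.add_sub_cancel]
  push_cast
  field_simp
  ring
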